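/- Let R ≥ 2 and let k_1, …, k_R ≥ 3 be integers with each value occurring at most twice among k_1, …, k_R. For each i, let A_i ⊆ P(3^{k_i}) be either P(3^{k_i}) ∖ {(3^{k_i}−1, 1), (2, 1^{3^{k_i}−2})}, in which case set N_i := 3^{k_i}, or B_{3^{k_i}}(3^{k_i}−1), in which case set N_i := 3^{k_i}−1. Then A_1 ⋆ A_2 ⋆ ⋯ ⋆ A_R = B_n(N_1 + ⋯ + N_R), where n := 3^{k_1} + ⋯ + 3^{k_R}. (In particular, when every A_i is of the first kind, the product equals P(n).) -/

import Mathlib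

open scoped Classical

namespace SylowBranching

/-- The cells of the Young diagram of `f` (rows indexed by the first coordinate,
starting from `0`; `f i` is the length of row `i`). -/
def cellsOf (f : ℕ → ℕ) : Set (ℕ × ℕ) := {p | p.2 < f p.1}

/-- `f : ℕ → ℕ` is a partition if it is weakly decreasing with finitely many
nonzero parts.  Its parts are `f 0 ≥ f 1 ≥ ⋯`, and its largest part is `f 0`. -/
def IsPartition (f : ℕ → ℕ) : Prop :=
  Antitone f ∧ ∃ N, ∀ i, N ≤ i → f i = 0

/-- The size `|f|` of a partition: the number of cells of its Young diagram. -/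
noncomputable def psize (f : ℕ → ℕ) : ℕ := (cellsOf f).ncard

/-- `P(n)`: the set of partitions of `n`. -/
def Pset (n : ℕ) : Set (ℕ → ℕ) := {f | IsPartition f ∧ psize f = n}

/-- The conjugate (transpose) partition `f'`. -/
noncomputable def conj (f : ℕ → ℕ) : ℕ → ℕ := fun j => Set.ncard {i | j < f i}

/-- `A° = A ∪ A'`: the closure of a set of partitions under conjugation. -/
noncomputable def conjClosure (A : Set (ℕ → ℕ)) : Set (ℕ → ℕ) := A ∪ conj '' A

/-- `B_n(t)`: partitions of `n` with largest part at most `t` and at most `t` parts. -/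
noncomputable def Bset (n t : ℕ) : Set (ℕ → ℕ) :=
  {f ∈ Pset n | f 0 ≤ t ∧ conj f 0 ≤ t}

/-- The cells of the skew shape `l / m`. -/
def skewCells (l m : ℕ → ℕ) : Set (ℕ × ℕ) :=
  {p | m p.1 ≤ p.2 ∧ p.2 < l p.1}

/-- `d` is read before (or at the same time as) `c` in the reading order of a
filling: right-to-left along rows, rows from top to bottom. -/
def readBefore (d c : ℕ × ℕ) : Prop :=
  d.1 < c.1 ∨ (d.1 = c.1 ∧ c.2 ≤ d.2)

/-- A Littlewood–Richardson filling of the cell set `γ` of weight `ν`: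
all entries are positive; for every `j ≥ 1` there are exactly `ν (j-1)` entries
equal to `j` (i.e. the number of `j`s is the `j`-th part of `ν`); entries weakly
increase along rows and strictly increase down columns; and every initial
segment of the reading word (right-to-left along rows, top to bottom) contains
at least as many entries equal to `j` as entries equal to `j+1`, for all `j ≥ 1`. -/
structure IsLRFilling (γ : Set (ℕ × ℕ)) (ν : ℕ → ℕ) (T : ℕ × ℕ → ℕ) : Prop where
  pos : ∀ c ∈ γ, 1 ≤ T c
  weight : ∀ j : ℕ, 1 ≤ j → Set.ncard {c ∈ γ | T c = j} = ν (j - 1)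
  row_weak : ∀ i j j', (i, j) ∈ γ → (i, j') ∈ γ → j ≤ j' → T (i, j) ≤ T (i, j')
  col_strict : ∀ i i' j, (i, j) ∈ γ → (i', j) ∈ γ → i < i' → T (i, j) < T (i', j)
  lattice : ∀ c ∈ γ, ∀ j : ℕ, 1 ≤ j →
    Set.ncard {d ∈ γ | T d = j + 1 ∧ readBefore d c} ≤
      Set.ncard {d ∈ γ | T d = j ∧ readBefore d c}

/-- `LR(γ)`: the set of all weights of LR fillings of `γ`. -/
def LRset (γ : Set (ℕ × ℕ)) : Set (ℕ → ℕ) := {ν | ∃ T, IsLRFilling γ ν T}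

/-- The Littlewood–Richardson coefficient `c^l_{m ν}`: the number of LR fillings
of the skew shape `l / m` of weight `ν` (zero unless `m ⊆ l`); fillings are
normalised to vanish off the skew shape so that they can be counted. -/
noncomputable def LRcoeff (l m ν : ℕ → ℕ) : ℕ :=
  Set.ncard {T : ℕ × ℕ → ℕ |
    (∀ i, m i ≤ l i) ∧ (∀ c, c ∉ skewCells l m → T c = 0) ∧
      IsLRFilling (skewCells l m) ν T}

/-- The `⋆` operation on sets of partitions:
`A ⋆ B = {λ : c^λ_{μν} > 0 for some μ ∈ A, ν ∈ B}`. -/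
def starOp (A B : Set (ℕ → ℕ)) : Set (ℕ → ℕ) :=
  {l | IsPartition l ∧ ∃ μ ∈ A, ∃ ν ∈ B, 0 < LRcoeff l μ ν}

/-- The partition with the given (weakly decreasing) list of parts. -/
def ofList (L : List ℕ) : ℕ → ℕ := fun i => L.getD i 0

/-- The hook partition `(a, 1^b)`. -/
def hookP (a b : ℕ) : ℕ → ℕ := ofList (a :: List.replicate b 1)

/-- The partition `(a, μ)` obtained by prepending a first part `a` to `μ`. -/
def consPart (a : ℕ) (μ : ℕ → ℕ) : ℕ → ℕ := fun i => if i = 0 then a else μ (i - 1)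

/-- `γ` coincides, up to planar translation, with the Young diagram of `ν`. -/
def TranslateOf (γ : Set (ℕ × ℕ)) (ν : ℕ → ℕ) : Prop :=
  ∃ a b : ℕ, γ = (fun p : ℕ × ℕ => (p.1 + a, p.2 + b)) '' cellsOf ν

/-- `γ` coincides, up to planar translation, with the 180°-rotation of the
Young diagram of `ν`. -/
def RotationOf (γ : Set (ℕ × ℕ)) (ν : ℕ → ℕ) : Prop :=
  ∃ a b : ℕ, (∀ p ∈ cellsOf ν, p.1 ≤ a ∧ p.2 ≤ b) ∧
    γ = (fun p : ℕ × ℕ => (a - p.1, b - p.2)) '' cellsOf ν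

/-- Iterated Littlewood–Richardson coefficients `c^l_{μ^1, …, μ^r}`:
`c^l_{μ} = δ_{l μ}`, and the coefficient for a longer list is obtained by
summing, over partitions `g` of the total size of the remaining factors, the
product of the iterated coefficient of `g` with `c^l_{g μ}`. -/
noncomputable def iterLR : List (ℕ → ℕ) → (ℕ → ℕ) → ℕ
  | [], l => if l = (fun _ => 0 : ℕ → ℕ) then 1 else 0
  | [μ], l => if l = μ then 1 else 0
  | μ :: μs, l =>
      ∑' g : {g : ℕ → ℕ // IsPartition g ∧ psize g = (μs.map psize).sum},
        iterLR μs g.1 * LRcoeff l g.1 μ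

/-- `D(q, m, B)`: partitions `λ` of `qm` with `c^λ_{μ_1, …, μ_q} > 0` for some
`μ_1, …, μ_q ∈ B` that are not all equal. -/
noncomputable def Dset (q m : ℕ) (B : Set (ℕ → ℕ)) : Set (ℕ → ℕ) :=
  {l ∈ Pset (q * m) | ∃ μ : Fin q → (ℕ → ℕ),
    (∀ i, μ i ∈ B) ∧ (∃ i j, μ i ≠ μ j) ∧ 0 < iterLR (List.ofFn μ) l}

/-- Iterated `⋆` of a list of sets of partitions. -/
def starAll : List (Set (ℕ → ℕ)) → Set (ℕ → ℕ)
  | [] => Pset 0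
  | [A] => A
  | A :: B :: rest => starOp A (starAll (B :: rest))

/-- `Ω(φ(1,0,…,0))` for the Sylow 3-subgroup of `S_{3^k}` (`k ≥ 4`):
`B_{3^k}(2a) ∖ {(2a, a−1, 1), (2a, 2, 1^{a−2}), (2a−1, a+1), (2a−1, 1^{a+1})}°`
where `a = 3^{k−1}`. -/
noncomputable def Cset (k : ℕ) : Set (ℕ → ℕ) :=
  Bset (3 ^ k) (2 * 3 ^ (k - 1)) \
    conjClosure
      {ofList [2 * 3 ^ (k - 1), 3 ^ (k - 1) - 1, 1],
       ofList (2 * 3 ^ (k - 1) :: 2 :: List.replicate (3 ^ (k - 1) - 2) 1),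
       ofList [2 * 3 ^ (k - 1) - 1, 3 ^ (k - 1) + 1],
       hookP (2 * 3 ^ (k - 1) - 1) (3 ^ (k - 1) + 1)}

lemma cellsOf_eq_biUnion {f : ℕ → ℕ} {D : ℕ} (hD : ∀ i, D ≤ i → f i = 0) :
    cellsOf f =
      ((Finset.range D).biUnion fun i => (Finset.range (f i)).image (Prod.mk i) :
        Finset (ℕ × ℕ)) := by
  ext ⟨i, j⟩
  simp only [cellsOf, Set.mem_ofPred_eq, Finset.coe_biUnion, Finset.coe_range, Set.mem_Iio,
    Finset.coe_image, Set.mem_iUnion, Set.mem_image, Prod.mk.injEq]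
  constructor
  · intro h
    refine ⟨i, ?_, j, h, rfl, rfl⟩
    by_contra hi
    rw [hD i (by omega)] at h
    omega
  · rintro ⟨i', -, j', h, rfl, rfl⟩
    exact h

lemma psize_eq_sum {f : ℕ → ℕ} {D : ℕ} (hD : ∀ i, D ≤ i → f i = 0) :
    psize f = ∑ i ∈ Finset.range D, f i := by
  rw [psize, cellsOf_eq_biUnion hD, Set.ncard_coe_finset, Finset.card_biUnion]
  · refine Finset.sum_congr rfl fun i _ => ?_
    rw [Finset.card_image_of_injective _ (Prod.mk_right_injective i), Finset.card_range]
  · intro i _ i' _ hii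
    rw [Function.onFun, Finset.disjoint_left]
    simp only [Finset.mem_image, Finset.mem_range, not_exists, not_and, forall_exists_index,
      and_imp]
    rintro _ j _ rfl j' _ h
    exact hii (Prod.mk.inj h).1.symm

lemma IsPartition.finite_cellsOf {f : ℕ → ℕ} (hf : IsPartition f) : (cellsOf f).Finite := by
  obtain ⟨D, hD⟩ := hf.2
  rw [cellsOf_eq_biUnion hD]
  exact Finset.finite_toSet _

lemma IsPartition.finite_skewCells {l : ℕ → ℕ} (hl : IsPartition l) (m : ℕ → ℕ) :
    (skewCells l m).Finite :=
  hl.finite_cellsOf.subset fun _ hp => hp.2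

lemma psize_add_ncard_skewCells {l m : ℕ → ℕ} (hl : IsPartition l) (h : ∀ i, m i ≤ l i) :
    psize m + (skewCells l m).ncard = psize l := by
  have hunion : cellsOf l = cellsOf m ∪ skewCells l m := by
    ext p
    have := h p.1
    simp only [cellsOf, skewCells, Set.mem_ofPred_eq, Set.mem_union]
    omega
  have hdisj : Disjoint (cellsOf m) (skewCells l m) := by
    rw [Set.disjoint_left]
    intro p hp hq
    simp only [cellsOf, skewCells, Set.mem_ofPred_eq] at hp hq
    omega
  rw [psize, psize, hunion, Set.ncard_union_eq hdisj
    (hl.finite_cellsOf.subset (hunion ▸ Set.subset_union_left)) (hl.finite_skewCells m)]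

/-- The Galois connection between a partition and its conjugate. -/
lemma IsPartition.conj_le_iff {f : ℕ → ℕ} (hf : IsPartition f) {j t : ℕ} :
    conj f j ≤ t ↔ f t ≤ j := by
  obtain ⟨D, hD⟩ := hf.2
  have hfin : {i | j < f i}.Finite := by
    refine (Set.finite_Iio D).subset fun i hi => ?_
    by_contra hiD
    rw [Set.mem_ofPred_eq, hD i (by simpa using hiD)] at hi
    omega
  constructor
  · intro h
    by_contra! hj
    have hsub : (Finset.range (t + 1) : Set ℕ) ⊆ {i | j < f i} := fun i hi =>
      lt_of_lt_of_le hj (hf.1 (by simpa [Nat.lt_succ_iff] using hi))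
    have := Set.ncard_le_ncard hsub hfin
    rw [Set.ncard_coe_finset, Finset.card_range] at this
    rw [conj] at h
    omega
  · intro h
    have hsub : {i | j < f i} ⊆ (Finset.range t : Set ℕ) := fun i hi => by
      by_contra hit
      have := hf.1 (show t ≤ i by simpa using hit)
      simp only [Set.mem_ofPred_eq] at hi
      omega
    have := Set.ncard_le_ncard hsub
    rwa [Set.ncard_coe_finset, Finset.card_range] at this

lemma mem_Bset_iff {f : ℕ → ℕ} {n t : ℕ} :
    f ∈ Bset n t ↔ IsPartition f ∧ psize f = n ∧ f 0 ≤ t ∧ f t = 0 := by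
  constructor
  · rintro ⟨⟨hf, hn⟩, h0, ht⟩
    exact ⟨hf, hn, h0, Nat.le_zero.mp (hf.conj_le_iff.mp ht)⟩
  · rintro ⟨hf, hn, h0, ht⟩
    exact ⟨⟨hf, hn⟩, h0, hf.conj_le_iff.mpr ht.le⟩

/-- A nonempty row and the first row together span a hook inside the diagram. -/
lemma IsPartition.add_le_psize {f : ℕ → ℕ} (hf : IsPartition f) {t : ℕ} (ht : f t ≠ 0) :
    f 0 + t ≤ psize f := by
  obtain ⟨D, hD⟩ := hf.2
  have htD : t < D := by
    by_contra h
    exact ht (hD t (by omega))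
  rw [psize_eq_sum hD]
  have hsub : Finset.range (t + 1) ⊆ Finset.range D := by
    intro i hi
    simp only [Finset.mem_range] at *
    omega
  refine le_trans ?_ (Finset.sum_le_sum_of_subset hsub)
  rw [Finset.sum_range_succ']
  have : ∑ i ∈ Finset.range t, 1 ≤ ∑ i ∈ Finset.range t, f (i + 1) :=
    Finset.sum_le_sum fun i hi => by
      have := hf.1 (show i + 1 ≤ t by simpa using hi)
      omega
  simp at this
  omega

lemma IsPartition.apply_zero_le_psize {f : ℕ → ℕ} (hf : IsPartition f) : f 0 ≤ psize f := by
  by_cases h : f 0 = 0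
  · omega
  · simpa using hf.add_le_psize h

lemma IsPartition.apply_eq_zero_of_psize_le {f : ℕ → ℕ} (hf : IsPartition f) {t : ℕ}
    (ht : psize f ≤ t) : f t = 0 := by
  by_contra h
  have := hf.add_le_psize h
  have := hf.1 (Nat.zero_le t)
  omega

/-- Between two nested partitions there is a partition of every intermediate size. -/
lemma exists_partition_between {α β : ℕ → ℕ} (hα : Antitone α) (hβ : IsPartition β)
    (hle : ∀ i, α i ≤ β i) {m : ℕ} (hαm : psize α ≤ m) (hmβ : m ≤ psize β) :
    ∃ μ, IsPartition μ ∧ psize μ = m ∧ (∀ i, α i ≤ μ i) ∧ ∀ i, μ i ≤ β i := by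
  obtain ⟨d, hd⟩ := Nat.exists_eq_add_of_le hmβ
  induction d generalizing β with
  | zero => exact ⟨β, hβ, hd, hle, fun _ => le_rfl⟩
  | succ d ih =>
    obtain ⟨D, hD⟩ := hβ.2
    have hDα : ∀ i, D ≤ i → α i = 0 := fun i hi => by
      have := hle i
      rw [hD i hi] at this
      omega
    have hex : ∃ i, i < D ∧ α i < β i := by
      by_contra! hno
      have : psize β ≤ psize α := by
        rw [psize_eq_sum hD, psize_eq_sum hDα]
        exact Finset.sum_le_sum fun i hi => hno i (by simpa using hi)
      omega
    obtain ⟨i₀, hi₀⟩ := hex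
    set k := Nat.findGreatest (fun i => i < D ∧ α i < β i) D with hk
    have hkspec : k < D ∧ α k < β k :=
      Nat.findGreatest_spec (P := fun i => i < D ∧ α i < β i) hi₀.1.le hi₀
    have hafter : ∀ i, k < i → β i ≤ α i := fun i hi => by
      by_cases hiD : i < D
      · have := Nat.findGreatest_is_greatest (P := fun i => i < D ∧ α i < β i) hi hiD.le
        by_contra hlt
        exact this ⟨hiD, by omega⟩
      · rw [hD i (by omega)]
        omega
    have hval : ∀ i, Function.update β k (β k - 1) i = if i = k then β k - 1 else β i :=
      fun i => Function.update_apply ..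
    have hpart : IsPartition (Function.update β k (β k - 1)) := by
      refine ⟨fun i j hij => ?_, D, fun i hi => ?_⟩
      · rw [hval, hval]
        have h1 := hβ.1 hij
        split_ifs with hj hi hi
        · omega
        · subst hj; omega
        · subst hi
          have h2 := hafter j (by omega)
          have h3 := hα hij
          omega
        · exact h1
      · rw [hval, if_neg (by omega), hD i hi]
    have hsize : psize (Function.update β k (β k - 1)) + 1 = psize β := by
      rw [psize_eq_sum hD, psize_eq_sum (D := D) (fun i hi => by
        rw [hval, if_neg (by omega), hD i hi]), Finset.sum_update_of_mem (by simpa using hkspec.1),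
        ← Finset.add_sum_erase _ _ (Finset.mem_range.mpr hkspec.1),
        Finset.sdiff_singleton_eq_erase]
      omega
    obtain ⟨μ, h1, h2, h3, h4⟩ := ih hpart (fun i => by
      rw [hval]
      split_ifs with hi
      · subst hi; omega
      · exact hle i) (by omega) (by omega)
    refine ⟨μ, h1, h2, h3, fun i => (h4 i).trans ?_⟩
    rw [hval]
    split_ifs with hi
    · subst hi; omega
    · exact le_rfl

/-- Positivity of a Littlewood–Richardson coefficient, as existence of a filling. -/
def LRPos (l m ν : ℕ → ℕ) : Prop :=
  (∀ i, m i ≤ l i) ∧ ∃ T, IsLRFilling (skewCells l m) ν T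

lemma LRPos_of_LRcoeff_pos {l m ν : ℕ → ℕ} (h : 0 < LRcoeff l m ν) : LRPos l m ν := by
  obtain ⟨T, hT⟩ := Set.nonempty_of_ncard_ne_zero h.ne'
  exact ⟨hT.1, T, hT.2.2⟩

lemma IsLRFilling.weight_pos {γ : Set (ℕ × ℕ)} {ν : ℕ → ℕ} {T : ℕ × ℕ → ℕ}
    (hT : IsLRFilling γ ν T) (hγ : γ.Finite) {c : ℕ × ℕ} (hc : c ∈ γ) : 0 < ν (T c - 1) := by
  rw [← hT.weight _ (hT.pos c hc), Set.ncard_pos (hγ.subset (Set.sep_subset _ _))]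
  exact ⟨c, hc, rfl⟩

lemma IsLRFilling.congr {γ : Set (ℕ × ℕ)} {ν : ℕ → ℕ} {T T' : ℕ × ℕ → ℕ}
    (hT : IsLRFilling γ ν T) (h : ∀ c ∈ γ, T' c = T c) : IsLRFilling γ ν T' where
  pos c hc := by rw [h c hc]; exact hT.pos c hc
  weight j hj := by
    rw [← hT.weight j hj]
    congr 1
    ext c
    exact and_congr_right fun hc => by rw [h c hc]
  row_weak i j j' h1 h2 hjj := by rw [h _ h1, h _ h2]; exact hT.row_weak i j j' h1 h2 hjj
  col_strict i i' j h1 h2 hii := by rw [h _ h1, h _ h2]; exact hT.col_strict i i' j h1 h2 hii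
  lattice c hc j hj := by
    convert hT.lattice c hc j hj using 2 <;>
    · ext d
      exact and_congr_right fun hd => by rw [h d hd]

lemma LRcoeff_pos_of_LRPos {l m ν : ℕ → ℕ} (hl : IsPartition l) (hν : IsPartition ν)
    (h : LRPos l m ν) : 0 < LRcoeff l m ν := by
  have hγ := hl.finite_skewCells m
  obtain ⟨hml, T, hT⟩ := h
  refine (Set.ncard_pos ?_).mpr ?_
  swap
  · refine ⟨fun c => if c ∈ skewCells l m then T c else 0, hml, fun c hc => if_neg hc,
      hT.congr fun c hc => if_pos hc⟩
  · obtain ⟨D, hD⟩ := hν.2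
    have := hγ.to_subtype
    refine Set.Finite.of_finite_image (f := fun T (c : skewCells l m) => T c.1)
      ((Set.Finite.pi' fun _ : skewCells l m => Set.finite_Iic D).subset ?_) ?_
    · rintro _ ⟨T', ⟨-, -, hT'⟩, rfl⟩ c
      have := hT'.weight_pos hγ c.2
      by_contra hlt
      rw [hD _ (by simp only [Set.mem_Iic] at hlt; omega)] at this
      omega
    · rintro T₁ ⟨-, h₁, -⟩ T₂ ⟨-, h₂, -⟩ heq
      funext c
      by_cases hc : c ∈ skewCells l m
      · exact congrFun heq ⟨c, hc⟩
      · rw [h₁ c hc, h₂ c hc]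

lemma IsLRFilling.ncard_eq {γ : Set (ℕ × ℕ)} {ν : ℕ → ℕ} {T : ℕ × ℕ → ℕ}
    (hT : IsLRFilling γ ν T) (hγ : γ.Finite) (hν : IsPartition ν) : γ.ncard = psize ν := by
  obtain ⟨D, hD⟩ := hν.2
  rw [psize_eq_sum hD, Set.ncard_eq_toFinset_card γ hγ,
    Finset.card_eq_sum_card_fiberwise (f := fun c => T c - 1) (t := Finset.range D)]
  · refine Finset.sum_congr rfl fun j _ => ?_
    rw [← Nat.add_sub_cancel j 1, ← hT.weight (j + 1) (by omega), ← Set.ncard_coe_finset]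
    congr 1
    ext c
    simp only [Finset.coe_filter, Set.Finite.mem_toFinset, Set.mem_ofPred_eq]
    refine and_congr_right fun hc => ?_
    have := hT.pos c hc
    omega
  · intro c hc
    have hc' : c ∈ γ := by simpa using hc
    have := hT.weight_pos hγ hc'
    rw [Finset.coe_range, Set.mem_Iio]
    by_contra hlt
    rw [hD _ (by dsimp only at hlt; omega)] at this
    omega

lemma LRPos.psize_eq {l m ν : ℕ → ℕ} (h : LRPos l m ν) (hl : IsPartition l)
    (hν : IsPartition ν) : psize l = psize m + psize ν := by
  obtain ⟨hml, T, hT⟩ := h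
  rw [← hT.ncard_eq (hl.finite_skewCells m) hν, psize_add_ncard_skewCells hl hml]

lemma LRPos.apply_zero_le {l m ν : ℕ → ℕ} (h : LRPos l m ν) (hl : IsPartition l) :
    l 0 ≤ m 0 + ν 0 := by
  obtain ⟨hml, T, hT⟩ := h
  have hγ := hl.finite_skewCells m
  by_cases hlt : m 0 < l 0
  swap
  · omega
  have hc : (0, l 0 - 1) ∈ skewCells l m := ⟨by dsimp only; omega, by dsimp only; omega⟩
  have hlast : T (0, l 0 - 1) = 1 := by
    have hpos := hT.pos _ hc
    by_contra hne
    have hlat := hT.lattice _ hc (T (0, l 0 - 1) - 1) (by omega)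
    rw [Nat.sub_add_cancel hpos] at hlat
    have h1 : 0 < Set.ncard {d ∈ skewCells l m |
        T d = T (0, l 0 - 1) ∧ readBefore d (0, l 0 - 1)} := by
      rw [Set.ncard_pos (hγ.subset (Set.sep_subset _ _))]
      exact ⟨_, hc, rfl, Or.inr ⟨rfl, le_rfl⟩⟩
    have h2 : {d ∈ skewCells l m |
        T d = T (0, l 0 - 1) - 1 ∧ readBefore d (0, l 0 - 1)} = ∅ := by
      ext ⟨i, j⟩
      simp only [Set.mem_ofPred_eq, Set.mem_empty_iff_false, iff_false]
      rintro ⟨hd, hTd, h | ⟨h, h'⟩⟩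
      · simp at h
      · simp only at h h'
        subst h
        have hj : j = l 0 - 1 := by
          have := hd.2
          dsimp only at this
          omega
        subst hj
        omega
    rw [h2, Set.ncard_empty] at hlat
    omega
  have hsub : (Prod.mk 0) '' (Finset.Ico (m 0) (l 0) : Set ℕ) ⊆
      {c ∈ skewCells l m | T c = 1} := by
    rintro _ ⟨j, hj, rfl⟩
    simp only [Finset.coe_Ico, Set.mem_Ico] at hj
    have hjγ : ((0, j) : ℕ × ℕ) ∈ skewCells l m := hj
    have h1 := hT.row_weak 0 j (l 0 - 1) hjγ hc (by omega)
    have h2 := hT.pos _ hjγ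
    exact ⟨hjγ, by omega⟩
  have := Set.ncard_le_ncard hsub (hγ.subset (Set.sep_subset _ _))
  rw [Set.ncard_image_of_injective _ (Prod.mk_right_injective 0), Set.ncard_coe_finset,
    Nat.card_Ico, hT.weight 1 le_rfl] at this
  simp only [Nat.sub_self] at this
  omega

lemma LRPos.apply_add_eq_zero {l m ν : ℕ → ℕ} (h : LRPos l m ν) (hl : IsPartition l)
    (hm : IsPartition m) (hν : IsPartition ν) {M N : ℕ} (hM : m M = 0) (hN : ν N = 0) :
    l (M + N) = 0 := by
  obtain ⟨hml, T, hT⟩ := h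
  by_contra hne
  have hmem : ∀ i, i ≤ N → ((M + i, 0) : ℕ × ℕ) ∈ skewCells l m := fun i hi => by
    have h1 := hm.1 (show M ≤ M + i by omega)
    have h2 := hl.1 (show M + i ≤ M + N by omega)
    exact ⟨by dsimp only; omega, by dsimp only; omega⟩
  have hval : ∀ i, i ≤ N → i + 1 ≤ T (M + i, 0) := by
    intro i
    induction i with
    | zero => exact fun hi => hT.pos _ (hmem 0 hi)
    | succ i ih =>
      intro hi
      have h1 := ih (by omega)
      have h2 := hT.col_strict (M + i) (M + (i + 1)) 0 (hmem _ (by omega)) (hmem _ hi) (by omega)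
      omega
  have h1 := hval N le_rfl
  have h2 := hT.weight_pos (hl.finite_skewCells m) (hmem N le_rfl)
  have h3 := hν.1 (show N ≤ T (M + N, 0) - 1 by omega)
  omega

lemma starOp_Bset_subset (m n M N : ℕ) :
    starOp (Bset m M) (Bset n N) ⊆ Bset (m + n) (M + N) := by
  rintro l ⟨hl, μ, hμ, ν, hν, hpos⟩
  have h := LRPos_of_LRcoeff_pos hpos
  rw [mem_Bset_iff] at hμ hν ⊢
  obtain ⟨hμp, hμs, hμ0, hμM⟩ := hμ
  obtain ⟨hνp, hνs, hν0, hνN⟩ := hν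
  have := h.psize_eq hl hνp
  have := h.apply_zero_le hl
  exact ⟨hl, by omega, by omega, h.apply_add_eq_zero hl hμp hνp hμM hνN⟩

/-- The weight of the filling of `l / m` in which every column reads `1, 2, 3, …`. -/
noncomputable def colWeight (l m : ℕ → ℕ) : ℕ → ℕ :=
  fun j => Set.ncard {c | c < l (conj m c + j)}

lemma finite_colWeight_set {l : ℕ → ℕ} (hl : Antitone l) (m : ℕ → ℕ) (j : ℕ) :
    {c | c < l (conj m c + j)}.Finite :=
  (Set.finite_Iio (l 0)).subset fun _ hc => lt_of_lt_of_le hc (hl (Nat.zero_le _))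

lemma IsPartition.colWeight {l : ℕ → ℕ} (hl : IsPartition l) (m : ℕ → ℕ) :
    IsPartition (colWeight l m) := by
  obtain ⟨D, hD⟩ := hl.2
  refine ⟨fun i j hij => Set.ncard_le_ncard (fun c hc => ?_) (finite_colWeight_set hl.1 m i), D,
    fun i hi => ?_⟩
  · exact lt_of_lt_of_le hc (hl.1 (by omega))
  · have : {c | c < l (conj m c + i)} = ∅ := by
      ext c
      simp [hD (conj m c + i) (by omega)]
    rw [SylowBranching.colWeight, this, Set.ncard_empty]

lemma LRPos_colWeight {l m : ℕ → ℕ} (hl : IsPartition l) (hm : IsPartition m)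
    (h : ∀ i, m i ≤ l i) : LRPos l m (colWeight l m) := by
  have hγ := hl.finite_skewCells m
  have hmem : ∀ i c, (i, c) ∈ skewCells l m ↔ conj m c ≤ i ∧ c < l i := fun i c => by
    rw [hm.conj_le_iff]; rfl
  refine ⟨h, fun p => p.1 - conj m p.2 + 1, ?_⟩
  constructor
  · exact fun c _ => Nat.le_add_left ..
  · intro j hj
    rw [colWeight, ← Set.ncard_image_of_injective (f := fun c => (conj m c + (j - 1), c)) _
      (fun a b hab => (Prod.mk.inj hab).2)]
    congr 1
    ext ⟨i, c⟩
    simp only [Set.mem_ofPred_eq, hmem, Set.mem_image, Prod.mk.injEq]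
    constructor
    · rintro ⟨⟨h1, h2⟩, h3⟩
      have hi : conj m c + (j - 1) = i := by omega
      exact ⟨c, hi ▸ h2, hi, rfl⟩
    · rintro ⟨c', h1, rfl, rfl⟩
      exact ⟨⟨by omega, h1⟩, by omega⟩
  · intro i c c' _ _ hcc
    have : conj m c' ≤ conj m c := by
      rw [hm.conj_le_iff]
      exact (hm.conj_le_iff.mp le_rfl).trans hcc
    dsimp only
    omega
  · intro i i' c hc _ hii
    have := ((hmem i c).mp hc).1
    dsimp only
    omega
  · rintro ⟨r, x⟩ _ j hj
    refine Set.ncard_le_ncard_of_injOn (fun p => (p.1 - 1, p.2)) ?_ ?_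
      (hγ.subset (Set.sep_subset _ _))
    · rintro ⟨i, c⟩ ⟨hp, hT, hb⟩
      rw [hmem] at hp
      dsimp only at hT hp
      refine ⟨(hmem _ _).mpr ⟨by dsimp only; omega, lt_of_lt_of_le hp.2 (hl.1 (Nat.sub_le ..))⟩, ?_, ?_⟩
      · dsimp only
        omega
      · left
        rcases hb with hb | ⟨hb, -⟩ <;> dsimp only at hb ⊢ <;> omega
    · rintro ⟨i, c⟩ ⟨-, hT, -⟩ ⟨i', c'⟩ ⟨-, hT', -⟩ heq
      simp only [Prod.mk.injEq] at heq hT hT' ⊢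
      omega

/-- If `m` contains the first `a` columns of `l` and each column of `l / m` has height at most
`t`, then the column filling has weight in `B_n(t)`. -/
lemma colWeight_mem_Bset {l m : ℕ → ℕ} (hl : IsPartition l) (hm : IsPartition m)
    (h : ∀ i, m i ≤ l i) {n a t : ℕ} (hn : psize l = psize m + n)
    (hcols : ∀ i, min (l i) a ≤ m i) (hheight : ∀ i, l (i + t) ≤ m i) (h0 : l 0 ≤ a + t) :
    colWeight l m ∈ Bset n t := by
  rw [mem_Bset_iff]
  have hconj : ∀ c, m (conj m c) ≤ c := fun c => hm.conj_le_iff.mp le_rfl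
  refine ⟨hl.colWeight m, ?_, ?_, ?_⟩
  · have := (LRPos_colWeight hl hm h).psize_eq hl (hl.colWeight m)
    omega
  · have hsub : {c | c < l (conj m c + 0)} ⊆ (Finset.Ico a (l 0) : Set ℕ) := fun c hc => by
      have h1 : c < l (conj m c) := hc
      have h2 := hconj c
      have h3 := hcols (conj m c)
      have h4 := hl.1 (Nat.zero_le (conj m c))
      simp only [Finset.coe_Ico, Set.mem_Ico]
      omega
    have := Set.ncard_le_ncard hsub
    rw [Set.ncard_coe_finset, Nat.card_Ico] at this
    rw [colWeight]
    omega
  · have : {c | c < l (conj m c + t)} = ∅ := by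
      ext c
      have h1 := hconj c
      have h2 := hheight (conj m c)
      simp only [Set.mem_ofPred_eq, Set.mem_empty_iff_false, iff_false]
      omega
    rw [colWeight, this, Set.ncard_empty]

lemma IsPartition.consPart {f : ℕ → ℕ} (hf : IsPartition f) {a : ℕ} (ha : f 0 ≤ a) :
    IsPartition (consPart a f) := by
  obtain ⟨D, hD⟩ := hf.2
  refine ⟨fun i j hij => ?_, D + 1, fun i hi => ?_⟩
  · simp only [SylowBranching.consPart]
    split_ifs with h1 h2 h2
    · exact le_rfl
    · omega
    · exact (hf.1 (Nat.zero_le _)).trans ha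
    · exact hf.1 (by omega)
  · rw [SylowBranching.consPart, if_neg (by omega), hD _ (by omega)]

lemma psize_consPart {f : ℕ → ℕ} (hf : IsPartition f) (a : ℕ) :
    psize (consPart a f) = a + psize f := by
  obtain ⟨D, hD⟩ := hf.2
  rw [psize_eq_sum hD, psize_eq_sum (D := D + 1) (fun i hi => by
    rw [consPart, if_neg (by omega), hD _ (by omega)]), Finset.sum_range_succ', add_comm]
  simp [consPart]

lemma IsPartition.tail {f : ℕ → ℕ} (hf : IsPartition f) : IsPartition fun i => f (i + 1) := by
  obtain ⟨D, hD⟩ := hf.2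
  exact ⟨fun i j hij => hf.1 (by omega), D, fun i hi => hD _ (by omega)⟩

lemma consPart_tail (f : ℕ → ℕ) : consPart (f 0) (fun i => f (i + 1)) = f := by
  funext i
  cases i <;> simp [consPart]

/-- Prepending a row to each of the three partitions preserves positivity. -/
lemma LRPos.consPart {l m ν : ℕ → ℕ} (h : LRPos l m ν) (hl : IsPartition l) {a b : ℕ}
    (hb : ν 0 ≤ b) : LRPos (consPart (a + b) l) (consPart a m) (consPart b ν) := by
  obtain ⟨hml, T, hT⟩ := h
  have hγ := hl.finite_skewCells m
  have hmem0 : ∀ c, (0, c) ∈ skewCells (SylowBranching.consPart (a + b) l)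
      (SylowBranching.consPart a m) ↔ a ≤ c ∧ c < a + b := fun c => by
    simp [skewCells, SylowBranching.consPart]
  have hmemS : ∀ i c, (i + 1, c) ∈ skewCells (SylowBranching.consPart (a + b) l)
      (SylowBranching.consPart a m) ↔ (i, c) ∈ skewCells l m := fun i c => by
    simp [skewCells, SylowBranching.consPart]
  set γ := skewCells (SylowBranching.consPart (a + b) l) (SylowBranching.consPart a m)
  set T' : ℕ × ℕ → ℕ := fun p => if p.1 = 0 then 1 else T (p.1 - 1, p.2) + 1 with hT'
  have hT0 : ∀ c, T' (0, c) = 1 := fun c => by simp [hT']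
  have hTS : ∀ i c, T' (i + 1, c) = T (i, c) + 1 := fun i c => by simp [hT']
  have hshift : Function.Injective fun p : ℕ × ℕ => (p.1 + 1, p.2) := by
    rintro ⟨i, c⟩ ⟨i', c'⟩ h
    simpa using h
  have hones : {c ∈ γ | T' c = 1} = Prod.mk 0 '' (Finset.Ico a (a + b) : Set ℕ) := by
    ext ⟨i, c⟩
    cases i with
    | zero => simp [hmem0, hT0]
    | succ i =>
      simp only [Set.mem_ofPred_eq, hmemS, hTS, Set.mem_image, Prod.mk.injEq]
      constructor
      · rintro ⟨h1, h2⟩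
        have := hT.pos _ h1
        omega
      · rintro ⟨_, _, h1, _⟩
        omega
  have hcard : {c ∈ γ | T' c = 1}.ncard = b := by
    rw [hones, Set.ncard_image_of_injective _ (Prod.mk_right_injective 0), Set.ncard_coe_finset,
      Nat.card_Ico]
    omega
  refine ⟨fun i => ?_, T', ?_⟩
  · cases i with
    | zero => simp [SylowBranching.consPart]
    | succ i => simpa [SylowBranching.consPart] using hml i
  constructor
  · rintro ⟨i, c⟩ _
    cases i with
    | zero => rw [hT0]
    | succ i => rw [hTS]; omega
  · intro j hj
    obtain rfl | ⟨j, rfl⟩ : j = 1 ∨ ∃ j', j = j' + 2 := by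
      rcases j with _ | _ | j
      · omega
      · exact Or.inl rfl
      · exact Or.inr ⟨j, rfl⟩
    · rw [hcard]
      simp [SylowBranching.consPart]
    · have := hT.weight (j + 1) (by omega)
      simp only [SylowBranching.consPart, Nat.add_sub_cancel] at this ⊢
      rw [show j + 2 - 1 = j + 1 by omega, if_neg (by omega), Nat.add_sub_cancel, ← this,
        ← Set.ncard_image_of_injective {c ∈ skewCells l m | _} hshift]
      congr 1
      ext ⟨i, c⟩
      cases i with
      | zero => simp [hT0]
      | succ i =>
        simp only [Set.mem_ofPred_eq, hTS, Set.mem_image, Prod.mk.injEq, Prod.exists,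
          Nat.add_right_cancel_iff, exists_eq_right_right, exists_eq_right, ← hmemS]
        exact and_congr_right fun _ => by omega
  · intro i c c' h1 h2 hcc
    cases i with
    | zero => rw [hT0, hT0]
    | succ i =>
      rw [hmemS] at h1 h2
      rw [hTS, hTS]
      have := hT.row_weak i c c' h1 h2 hcc
      omega
  · intro i i' c h1 h2 hii
    obtain ⟨i', rfl⟩ : ∃ k, i' = k + 1 := ⟨i' - 1, by omega⟩
    rw [hmemS] at h2
    rw [hTS]
    cases i with
    | zero =>
      rw [hT0]
      have := hT.pos _ h2
      omega
    | succ i =>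
      rw [hmemS] at h1
      rw [hTS]
      have := hT.col_strict i i' c h1 h2 (by omega)
      omega
  · rintro ⟨r, x⟩ hrx j hj
    cases r with
    | zero =>
      have : {d ∈ γ | T' d = j + 1 ∧ readBefore d (0, x)} = ∅ := by
        ext ⟨i, c⟩
        cases i with
        | zero =>
          simp only [Set.mem_ofPred_eq, hT0, Set.mem_empty_iff_false, iff_false]
          omega
        | succ i => simp [readBefore]
      rw [this, Set.ncard_empty]
      exact Nat.zero_le _
    | succ r =>
      have hcount : ∀ j, {d ∈ γ | T' d = j + 2 ∧ readBefore d (r + 1, x)}.ncard =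
          {d ∈ skewCells l m | T d = j + 1 ∧ readBefore d (r, x)}.ncard := fun j => by
        rw [← Set.ncard_image_of_injective {d ∈ skewCells l m | _} hshift]
        congr 1
        ext ⟨i, c⟩
        cases i with
        | zero => simp [hT0]
        | succ i => simp [hTS, hmemS, readBefore]
      rw [hmemS] at hrx
      obtain rfl | ⟨j, rfl⟩ : j = 1 ∨ ∃ j', j = j' + 2 := by
        rcases j with _ | _ | j
        · omega
        · exact Or.inl rfl
        · exact Or.inr ⟨j, rfl⟩
      · have h1 : {d ∈ γ | T' d = 1 ∧ readBefore d (r + 1, x)} = {c ∈ γ | T' c = 1} := by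
          ext ⟨i, c⟩
          cases i with
          | zero => simp [hT0, readBefore]
          | succ i =>
            simp only [Set.mem_ofPred_eq, hmemS, hTS]
            constructor
            · exact fun h => ⟨h.1, h.2.1⟩
            · rintro ⟨h1, h2⟩
              have := hT.pos _ h1
              omega
        rw [h1, hcard, hcount 0]
        refine le_trans ?_ hb
        rw [← hT.weight 1 le_rfl]
        exact Set.ncard_le_ncard (fun d hd => ⟨hd.1, hd.2.1⟩) (hγ.subset (Set.sep_subset _ _))
      · rw [hcount j, show j + 2 + 1 = (j + 1) + 2 by omega, hcount (j + 1)]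
        exact hT.lattice _ hrx (j + 1) (by omega)

lemma psize_add {f g : ℕ → ℕ} {D : ℕ} (hf : ∀ i, D ≤ i → f i = 0) (hg : ∀ i, D ≤ i → g i = 0) :
    psize (fun i => f i + g i) = psize f + psize g := by
  rw [psize_eq_sum hf, psize_eq_sum hg, psize_eq_sum (D := D) fun i hi => by
    rw [hf i hi, hg i hi], Finset.sum_add_distrib]

lemma psize_eq_sum_add_psize_shift {f : ℕ → ℕ} {D : ℕ} (hf : ∀ i, D ≤ i → f i = 0) (t : ℕ) :
    psize f = ∑ i ∈ Finset.range t, f i + psize fun i => f (i + t) := by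
  rw [psize_eq_sum (D := t + D) fun i hi => hf i (by omega), Finset.sum_range_add,
    psize_eq_sum (D := D) fun i hi => hf (i + t) (by omega)]
  simp only [add_comm]

lemma psize_const_zero : psize (fun _ => 0) = 0 := by
  rw [psize_eq_sum (D := 0) fun _ _ => rfl, Finset.sum_range_zero]

lemma IsPartition.sum_range_le_psize {f : ℕ → ℕ} (hf : IsPartition f) (t : ℕ) :
    ∑ i ∈ Finset.range t, f i ≤ psize f := by
  obtain ⟨D, hD⟩ := hf.2
  rw [psize_eq_sum_add_psize_shift hD t]
  exact Nat.le_add_right ..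

lemma IsPartition.mul_le_psize {f : ℕ → ℕ} (hf : IsPartition f) (t : ℕ) :
    (t + 1) * f t ≤ psize f := by
  refine le_trans ?_ (hf.sum_range_le_psize (t + 1))
  have := Finset.card_nsmul_le_sum (Finset.range (t + 1)) f (f t) fun i hi => hf.1 ?_
  · simpa using this
  simp at hi
  omega

/-- A partition of `m + n` has rows of length at most `K` from row `L` on. -/
lemma apply_le_of_psize {l : ℕ → ℕ} (hl : IsPartition l) {m n K L : ℕ} (hs : psize l = m + n)
    (hm : 27 ≤ m) (hn : 27 ≤ n) (hK : m ≤ K + 2) (hL : 12 * n ≤ 13 * L) : l L ≤ K := by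
  by_contra! hlt
  have h1 := hl.mul_le_psize L
  obtain ⟨x, rfl⟩ : ∃ x, L = x + 24 := ⟨L - 24, by omega⟩
  obtain ⟨y, hy⟩ : ∃ y, l (x + 24) = y + 26 := ⟨l (x + 24) - 26, by omega⟩
  rw [hy] at h1 hlt
  nlinarith [Nat.zero_le (x * y)]

lemma IsPartition.cut {f : ℕ → ℕ} (hf : IsPartition f) (a : ℕ) :
    IsPartition fun i => min (f i) a := by
  obtain ⟨D, hD⟩ := hf.2
  exact ⟨fun i j hij => min_le_min_right a (hf.1 hij), D, fun i hi => by simp [hD i hi]⟩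

lemma psize_cut_add {l : ℕ → ℕ} (hl : IsPartition l) (a : ℕ) :
    psize l = psize (fun i => min (l i) a) + psize fun i => l i - a := by
  obtain ⟨D, hD⟩ := hl.2
  rw [← psize_add (D := D) (fun i hi => by simp [hD i hi]) (fun i hi => by simp [hD i hi])]
  congr 1
  funext i
  omega

/-- The part of `l` inside the `K × K` square has at least `m` cells. -/
lemma le_psize_square {l : ℕ → ℕ} {m n K L : ℕ} (hl : IsPartition l) (hs : psize l = m + n)
    (hlKL : l (K + L) = 0) (h0 : l 0 ≤ L) (hm : 27 ≤ m) (hK : m ≤ K + 2) (hL : L ≤ n) :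
    m ≤ psize fun i => if i < K then min (l i) K else 0 := by
  have hzero : ∀ t, l t = 0 → ∀ i, t ≤ i → l i = 0 := fun t ht i hi => by
    have := hl.1 hi
    omega
  rw [psize_eq_sum (D := K) fun i hi => if_neg (by omega), Finset.sum_congr rfl
    fun i hi => if_pos (Finset.mem_range.mp hi)]
  have h10 := hl.1 (show 0 ≤ 1 by omega)
  by_cases hlK : l K = 0
  · by_cases hK0 : l 0 ≤ K
    · rw [psize_eq_sum (hzero K hlK)] at hs
      rw [Finset.sum_congr rfl fun i _ => min_eq_left ((hl.1 (Nat.zero_le i)).trans hK0)]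
      exact (Nat.le_add_right m n).trans hs.ge
    · obtain ⟨k, rfl⟩ : ∃ k, K = k + 3 := ⟨K - 3, by omega⟩
      rw [Finset.sum_range_succ', Finset.sum_range_succ', Finset.sum_range_succ']
      have h21 := hl.1 (show 1 ≤ 2 by omega)
      have : l 2 = 0 → psize l = l 0 + l 1 := fun h => by
        rw [psize_eq_sum (hzero 2 h)]
        simp [Finset.sum_range_succ]
      simp only [zero_add, Nat.reduceAdd]
      omega
  · obtain ⟨k, rfl⟩ : ∃ k, K = k + 2 := ⟨K - 2, by omega⟩
    rw [Finset.sum_range_succ', Finset.sum_range_succ']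
    have h1 : ∑ i ∈ Finset.range k, 1 ≤ ∑ i ∈ Finset.range k, min (l (i + 1 + 1)) (k + 2) :=
      Finset.sum_le_sum fun i hi => by
        have := hl.1 (show i + 1 + 1 ≤ k + 2 by simp at hi; omega)
        omega
    have h2 := hl.1 (show 1 ≤ k + 2 by omega)
    have h3 : l 1 ≤ 1 → psize l ≤ l 0 + (k + 1 + L) := fun h => by
      rw [psize_eq_sum (hzero _ hlKL), show k + 2 + L = (k + 1 + L) + 1 by omega,
        Finset.sum_range_succ', add_comm]
      have : ∑ i ∈ Finset.range (k + 1 + L), l (i + 1) ≤ ∑ i ∈ Finset.range (k + 1 + L), 1 :=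
        Finset.sum_le_sum fun i _ => (hl.1 (by omega)).trans h
      simp at this
      omega
    simp only [zero_add, Finset.sum_const, Finset.card_range, smul_eq_mul, mul_one] at h1 ⊢
    omega

lemma exists_LRPos_of_apply_zero_le {l : ℕ → ℕ} {m n K L : ℕ} (hl : IsPartition l)
    (hs : psize l = m + n) (hlKL : l (K + L) = 0) (h0 : l 0 ≤ L) (hm : 27 ≤ m) (hn : 27 ≤ n)
    (hKm : K ≤ m) (hK : m ≤ K + 2) (hLn : L ≤ n) (hL : 12 * n ≤ 13 * L) :
    ∃ μ ∈ Bset m K, ∃ ν ∈ Bset n L, LRPos l μ ν := by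
  have hzero : ∀ i, K + L ≤ i → l i = 0 := fun i hi => by
    have := hl.1 hi
    omega
  have hlL := apply_le_of_psize hl hs hm hn hK hL
  have hαm : psize (fun i => l (i + L)) ≤ m := by
    by_cases h2 : 2 ≤ l L
    · have h1 := psize_eq_sum_add_psize_shift hzero L
      have h3 : ∑ i ∈ Finset.range L, 2 ≤ ∑ i ∈ Finset.range L, l i :=
        Finset.sum_le_sum fun i hi => h2.trans (hl.1 (by simp at hi; omega))
      simp at h3
      omega
    · rw [psize_eq_sum (D := K) fun i hi => hzero _ (by omega)]
      have h3 : ∑ i ∈ Finset.range K, l (i + L) ≤ ∑ i ∈ Finset.range K, 1 :=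
        Finset.sum_le_sum fun i _ => (hl.1 (show L ≤ i + L by omega)).trans (by omega)
      simp at h3
      omega
  have hβ : IsPartition fun i => if i < K then min (l i) K else 0 := by
    refine ⟨fun i j hij => ?_, K, fun i hi => if_neg (by omega)⟩
    have := hl.1 hij
    dsimp only
    split_ifs <;> omega
  obtain ⟨μ, hμ, hμm, hαμ, hμβ⟩ := exists_partition_between
    (α := fun i => l (i + L)) (fun i j hij => hl.1 (by omega)) hβ (fun i => by
      have h1 := hl.1 (show i ≤ i + L by omega)
      have h2 := hl.1 (show L ≤ i + L by omega)
      split_ifs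
      · omega
      · exact (hzero _ (by omega)).le) hαm (le_psize_square hl hs hlKL h0 hm hK hLn)
  have hμl : ∀ i, μ i ≤ l i := fun i => (hμβ i).trans (by split_ifs <;> omega)
  refine ⟨μ, mem_Bset_iff.mpr ⟨hμ, hμm, ?_, ?_⟩, colWeight l μ,
    colWeight_mem_Bset hl hμ hμl (a := 0) (by omega) (by simp) hαμ (by omega),
    LRPos_colWeight hl hμ hμl⟩
  · have := hμβ 0
    split_ifs at this <;> omega
  · have := hμβ K
    simpa using this

/-- Splitting the first row of `l` as `a + b` and filling the remaining rows by columns. -/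
lemma exists_LRPos_consPart {l μ : ℕ → ℕ} (hl : IsPartition l) (hμ : IsPartition μ)
    (hμl : ∀ i, μ i ≤ l (i + 1)) {a b n L : ℕ} (hab : l 0 = a + b)
    (hs : psize l = a + psize μ + n) (hnb : n ≤ 2 * b) (hbL : b ≤ L) (hL : n + 1 ≤ L + b) :
    ∃ ν ∈ Bset n L, LRPos l (consPart a μ) ν := by
  have hpos := LRPos_colWeight hl.tail hμ hμl
  have hν := hl.tail.colWeight μ
  have hsize := hpos.psize_eq hl.tail hν
  have htail := psize_consPart hl.tail (l 0)
  rw [consPart_tail] at htail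
  have hνb := hν.apply_zero_le_psize
  have hres := hpos.consPart hl.tail (a := a) (b := b) (by omega)
  rw [← hab, consPart_tail] at hres
  refine ⟨_, mem_Bset_iff.mpr ⟨hν.consPart (a := b) (by omega), ?_, ?_, ?_⟩, hres⟩
  · rw [psize_consPart hν]
    omega
  · simpa [consPart] using hbL
  · by_cases hL0 : L = 0
    · simp only [consPart, hL0, if_true]
      omega
    · rw [consPart, if_neg hL0]
      exact hν.apply_eq_zero_of_psize_le (by omega)

lemma exists_LRPos_of_lt_apply_zero {l : ℕ → ℕ} {m n K L : ℕ} (hl : IsPartition l)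
    (hs : psize l = m + n) (h0 : l 0 ≤ K + L) (h0L : L < l 0) (hm : 27 ≤ m) (hn : 27 ≤ n)
    (hKm : K ≤ m) (hK : m ≤ K + 2) (hLn : L ≤ n) (hL : 12 * n ≤ 13 * L) :
    ∃ μ ∈ Bset m K, ∃ ν ∈ Bset n L, LRPos l μ ν := by
  obtain ⟨D, hD⟩ := hl.2
  have hlL := apply_le_of_psize hl hs hm hn hK hL
  obtain ⟨a, b, hab, hnb, hbL, haK, ha⟩ : ∃ a b, l 0 = a + b ∧ n ≤ 2 * b ∧ b ≤ L ∧ a ≤ K ∧ 4 ≤ a :=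
    ⟨l 0 - max ((n + 1) / 2) (l 0 - K), max ((n + 1) / 2) (l 0 - K), by omega, by omega,
      by omega, by omega, by omega⟩
  have hcut := psize_cut_add hl a
  have hsplit := psize_eq_sum_add_psize_shift (f := fun i => l i - a) (D := D)
    (fun i hi => by simp [hD i hi]) L
  obtain ⟨L', rfl⟩ : ∃ L', L = L' + 1 := ⟨L - 1, by omega⟩
  by_cases hexc : n < ∑ i ∈ Finset.range (L' + 1), (l i - a)
  · have hl1 : a < l 1 := by
      by_contra! hle
      rw [Finset.sum_range_succ', Finset.sum_eq_zero fun i _ => by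
        have := hl.1 (show 1 ≤ i + 1 by omega)
        omega] at hexc
      omega
    have hαm : psize (fun i => min (l i) a + (l (i + (L' + 1)) - a)) ≤ m := by
      rw [psize_add (D := D) (fun i hi => by simp [hD i hi])
        (fun i hi => by simp [hD (i + (L' + 1)) (by omega)])]
      omega
    have hmβ : m ≤ psize fun i => min (l i) K := by
      by_cases h : l 0 ≤ K
      · rw [funext fun i => min_eq_left ((hl.1 (Nat.zero_le i)).trans h)]
        omega
      · refine le_trans ?_ ((hl.cut K).sum_range_le_psize 2)
        simp only [Finset.sum_range_succ, Finset.sum_range_zero]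
        omega
    obtain ⟨μ, hμ, hμm, hαμ, hμβ⟩ := exists_partition_between
      (α := fun i => min (l i) a + (l (i + (L' + 1)) - a))
      (fun i j hij => by
        have h1 := hl.1 hij
        have h2 := hl.1 (show i + (L' + 1) ≤ j + (L' + 1) by omega)
        dsimp only
        omega)
      (hl.cut K) (fun i => by
        have h1 := hl.1 (show i ≤ i + (L' + 1) by omega)
        have h2 := hl.1 (show L' + 1 ≤ i + (L' + 1) by omega)
        omega) hαm hmβ
    have hμl : ∀ i, μ i ≤ l i := fun i => (hμβ i).trans (min_le_left ..)
    refine ⟨μ, mem_Bset_iff.mpr ⟨hμ, hμm, (hμβ 0).trans (min_le_right ..), ?_⟩, colWeight l μ,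
      colWeight_mem_Bset hl hμ hμl (a := a) (by omega)
        (fun i => le_trans (by omega) (hαμ i)) (fun i => ?_) (by omega),
      LRPos_colWeight hl hμ hμl⟩
    · by_contra hne
      have h1 := hμ.add_le_psize hne
      have h2 := hαμ 0
      omega
    · have h1 := hl.1 (show i ≤ i + (L' + 1) by omega)
      have h2 := hαμ i
      omega
  · have hla : l (L' + 1) ≤ a := by
      by_contra! hlt
      have h1 : ∑ i ∈ Finset.range L', 1 ≤ ∑ i ∈ Finset.range L', (l (i + 1) - a) :=
        Finset.sum_le_sum fun i hi => by
          have := hl.1 (show i + 1 ≤ L' + 1 by simp at hi; omega)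
          omega
      rw [Finset.sum_range_succ'] at hexc
      simp at h1
      omega
    have hshift : psize (fun i => l (i + (L' + 1)) - a) = 0 := by
      rw [funext fun i => Nat.sub_eq_zero_of_le ((hl.1 (Nat.le_add_left _ i)).trans hla),
        psize_const_zero]
    have hγ : psize (fun i => min (l i) a) = a + psize fun i => min (l (i + 1)) a := by
      rw [psize_eq_sum_add_psize_shift (D := D) (fun i hi => by simp [hD i hi]) 1,
        Finset.sum_range_one]
      omega
    obtain ⟨μ, hμ, hμm, -, hμγ⟩ := exists_partition_between (α := fun _ => 0)
      antitone_const (hl.tail.cut a) (fun _ => Nat.zero_le _) (m := m - a)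
      (by rw [psize_const_zero]; omega) (by omega)
    have hμl : ∀ i, μ i ≤ l (i + 1) := fun i => (hμγ i).trans (min_le_left ..)
    have hμ0 : μ 0 ≤ a := (hμγ 0).trans (min_le_right ..)
    refine ⟨_, mem_Bset_iff.mpr ⟨hμ.consPart hμ0, ?_, ?_, ?_⟩,
      exists_LRPos_consPart hl hμ hμl hab (by omega) hnb hbL (by omega)⟩
    · rw [psize_consPart hμ]
      omega
    · simpa [consPart] using haK
    · rw [consPart, if_neg (by omega)]
      exact hμ.apply_eq_zero_of_psize_le (by omega)

lemma exists_LRPos_of_mem_Bset {l : ℕ → ℕ} {m n K L : ℕ} (hl : l ∈ Bset (m + n) (K + L))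
    (hm : 27 ≤ m) (hn : 27 ≤ n) (hKm : K ≤ m) (hK : m ≤ K + 2) (hLn : L ≤ n)
    (hL : 12 * n ≤ 13 * L) : ∃ μ ∈ Bset m K, ∃ ν ∈ Bset n L, LRPos l μ ν := by
  obtain ⟨hlp, hs, h0, hKL⟩ := mem_Bset_iff.mp hl
  by_cases h : l 0 ≤ L
  · exact exists_LRPos_of_apply_zero_le hlp hs hKL h hm hn hKm hK hLn hL
  · exact exists_LRPos_of_lt_apply_zero hlp hs h0 (by omega) hm hn hKm hK hLn hL

/-- The one-row partition `(n)`. -/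
def rowP (n : ℕ) : ℕ → ℕ := consPart n fun _ => 0

/-- The one-column partition `(1^n)`. -/
def colP (n : ℕ) : ℕ → ℕ := fun i => if i < n then 1 else 0

lemma isPartition_zero : IsPartition fun _ => 0 := ⟨antitone_const, 0, fun _ _ => rfl⟩

lemma isPartition_rowP (n : ℕ) : IsPartition (rowP n) :=
  isPartition_zero.consPart (Nat.zero_le n)

lemma psize_rowP (n : ℕ) : psize (rowP n) = n := by
  rw [rowP, psize_consPart isPartition_zero, psize_const_zero, add_zero]

lemma isPartition_colP (n : ℕ) : IsPartition (colP n) := by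
  refine ⟨fun i j hij => ?_, n, fun i hi => if_neg (by omega)⟩
  simp only [colP]
  split_ifs <;> omega

lemma psize_colP (n : ℕ) : psize (colP n) = n := by
  have hz : ∀ i, n ≤ i → colP n i = 0 := fun i hi => if_neg (by omega)
  have hone : ∀ i ∈ Finset.range n, colP n i = 1 := fun i hi => if_pos (Finset.mem_range.mp hi)
  rw [psize_eq_sum hz, Finset.sum_congr rfl hone]
  simp

lemma IsPartition.eq_rowP {f : ℕ → ℕ} (hf : IsPartition f) (h : f 1 = 0) :
    f = rowP (psize f) := by
  have hz : ∀ i, 1 ≤ i → f i = 0 := fun i hi => by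
    have := hf.1 hi
    omega
  rw [psize_eq_sum hz, Finset.sum_range_one]
  funext i
  cases i with
  | zero => simp [rowP, SylowBranching.consPart]
  | succ i => simp [rowP, SylowBranching.consPart, hz]

lemma IsPartition.eq_colP {f : ℕ → ℕ} (hf : IsPartition f) (h : f 0 ≤ 1) :
    f = colP (psize f) := by
  have hle : ∀ i, f i ≤ 1 := fun i => (hf.1 (Nat.zero_le i)).trans h
  have hz : f (conj f 0) = 0 := Nat.le_zero.mp (hf.conj_le_iff.mp le_rfl)
  have hval : f = colP (conj f 0) := by
    funext i
    have h1 := hle i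
    rw [colP]
    split_ifs with hi
    · have : ¬ f i ≤ 0 := fun h => by
        have := hf.conj_le_iff.mpr h
        omega
      omega
    · have := hf.1 (show conj f 0 ≤ i by omega)
      omega
  rw [show psize f = conj f 0 by conv_lhs => rw [hval, psize_colP]]
  exact hval

/-- Two columns of a partition of heights more than `s` and `t` fit into its size. -/
lemma IsPartition.add_add_two_le_psize {f : ℕ → ℕ} (hf : IsPartition f) {s t : ℕ}
    (hs : 2 ≤ f s) (ht : f t ≠ 0) : s + t + 2 ≤ psize f := by
  obtain ⟨D, hD⟩ := hf.2
  have hsub : IsPartition fun i => f i - 1 :=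
    ⟨fun i j hij => Nat.sub_le_sub_right (hf.1 hij) 1, D, fun i hi => by simp [hD i hi]⟩
  have h1 := psize_cut_add hf 1
  have h2 := (hf.cut 1).mul_le_psize t
  have h3 := hsub.mul_le_psize s
  rw [min_eq_right (by omega)] at h2
  have h4 : (s + 1) * 1 ≤ (s + 1) * (f s - 1) := Nat.mul_le_mul_left _ (by omega)
  omega

lemma IsPartition.apply_zero_add_apply_one_le_psize {f : ℕ → ℕ} (hf : IsPartition f) :
    f 0 + f 1 ≤ psize f := by
  simpa [Finset.sum_range_succ] using hf.sum_range_le_psize 2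

lemma psize_colWeight {l m : ℕ → ℕ} (hl : IsPartition l) (hm : IsPartition m)
    (h : ∀ i, m i ≤ l i) {n : ℕ} (hn : psize l = psize m + n) : psize (colWeight l m) = n := by
  have := (LRPos_colWeight hl hm h).psize_eq hl (hl.colWeight m)
  omega

/-- A horizontal strip admits the filling by ones. -/
lemma LRPos_rowP {l m : ℕ → ℕ} (hl : IsPartition l) (hm : IsPartition m) (h : ∀ i, m i ≤ l i)
    {n : ℕ} (hn : psize l = psize m + n) (hstrip : ∀ i, l (i + 1) ≤ m i) :
    LRPos l m (rowP n) := by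
  have hzero : colWeight l m 1 = 0 := by
    have : {c | c < l (conj m c + 1)} = ∅ := by
      ext c
      have h1 : m (conj m c) ≤ c := hm.conj_le_iff.mp le_rfl
      have h2 := hstrip (conj m c)
      simp only [Set.mem_ofPred_eq, Set.mem_empty_iff_false, iff_false]
      omega
    rw [colWeight, this, Set.ncard_empty]
  have := LRPos_colWeight hl hm h
  rwa [(hl.colWeight m).eq_rowP hzero, psize_colWeight hl hm h hn] at this

/-- A skew shape contained in the first column admits the filling `1, 2, 3, …`. -/
lemma LRPos_colP {l m : ℕ → ℕ} (hl : IsPartition l) (hm : IsPartition m) (h : ∀ i, m i ≤ l i)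
    {n : ℕ} (hn : psize l = psize m + n) (hcol : ∀ i, m i < l i → l i ≤ 1) :
    LRPos l m (colP n) := by
  have hone : colWeight l m 0 ≤ 1 := by
    have hsub : {c | c < l (conj m c + 0)} ⊆ {0} := fun c hc => by
      have h1 : m (conj m c) ≤ c := hm.conj_le_iff.mp le_rfl
      have h2 : c < l (conj m c) := hc
      have h3 := hcol (conj m c) (by omega)
      rw [Set.mem_singleton_iff]
      omega
    simpa [colWeight] using Set.ncard_le_ncard hsub
  have := LRPos_colWeight hl hm h
  rwa [(hl.colWeight m).eq_colP hone, psize_colWeight hl hm h hn] at this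

lemma mem_starOp {A B : Set (ℕ → ℕ)} {l μ ν : ℕ → ℕ} (hl : IsPartition l) (hμ : μ ∈ A)
    (hν : ν ∈ B) (hνp : IsPartition ν) (h : LRPos l μ ν) : l ∈ starOp A B :=
  ⟨hl, μ, hμ, ν, hν, LRcoeff_pos_of_LRPos hl hνp h⟩

lemma starOp_mono {A A' B B' : Set (ℕ → ℕ)} (hA : A ⊆ A') (hB : B ⊆ B') :
    starOp A B ⊆ starOp A' B' := fun _ ⟨hl, μ, hμ, ν, hν, h⟩ => ⟨hl, μ, hA hμ, ν, hB hν, h⟩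

lemma Bset_subset_starOp {m n K L : ℕ} (hm : 27 ≤ m) (hn : 27 ≤ n) (hKm : K ≤ m)
    (hK : m ≤ K + 2) (hLn : L ≤ n) (hL : 12 * n ≤ 13 * L) :
    Bset (m + n) (K + L) ⊆ starOp (Bset m K) (Bset n L) := fun l hl => by
  obtain ⟨μ, hμ, ν, hν, h⟩ := exists_LRPos_of_mem_Bset hl hm hn hKm hK hLn hL
  exact mem_starOp hl.1.1 hμ hν hν.1.1 h

/-- The partitions of `m` other than `(m-1, 1)` and its conjugate. -/
def typeOne (m : ℕ) : Set (ℕ → ℕ) := Pset m \ {ofList [m - 1, 1], hookP 2 (m - 2)}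

lemma Bset_subset_typeOne {m : ℕ} (hm : 27 ≤ m) : Bset m (m - 2) ⊆ typeOne m := by
  rintro f ⟨hf, h0, hc⟩
  refine ⟨hf, ?_⟩
  rintro (rfl | rfl)
  · simp [ofList] at h0
    omega
  · have := hf.1.conj_le_iff.mp hc
    obtain ⟨k, rfl⟩ : ∃ k, m = k + 3 := ⟨m - 3, by omega⟩
    simp [hookP, ofList] at this

lemma typeOne_subset_Bset (m : ℕ) : typeOne m ⊆ Bset m m := by
  rintro f ⟨⟨hf, hs⟩, -⟩
  have := hf.apply_zero_le_psize
  exact mem_Bset_iff.mpr ⟨hf, hs, by omega, hf.apply_eq_zero_of_psize_le (by omega)⟩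

lemma rowP_mem_typeOne {m : ℕ} (hm : 27 ≤ m) : rowP m ∈ typeOne m := by
  refine ⟨⟨isPartition_rowP m, psize_rowP m⟩, ?_⟩
  rintro (h | h)
  · have := congrFun h 0
    simp [rowP, consPart, ofList] at this
    omega
  · have := congrFun h 0
    simp [rowP, consPart, hookP, ofList] at this
    omega

lemma colP_mem_typeOne {m : ℕ} (hm : 27 ≤ m) : colP m ∈ typeOne m := by
  refine ⟨⟨isPartition_colP m, psize_colP m⟩, ?_⟩
  rintro (h | h)
  · have := congrFun h 0
    simp only [colP, ofList, if_pos (show 0 < m by omega), List.getD_cons_zero] at this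
    omega
  · have := congrFun h 0
    simp [colP, hookP, ofList, show 0 < m by omega] at this

lemma Bset_subset_starOp_typeOne_left {m n L : ℕ} (hm : 27 ≤ m) (hn : 27 ≤ n) (hLn : L ≤ n)
    (hL : 12 * n ≤ 13 * L) : Bset (m + n) (m + L) ⊆ starOp (typeOne m) (Bset n L) := by
  intro l hl
  obtain ⟨hlp, hs, h0, hmL⟩ := mem_Bset_iff.mp hl
  by_cases hcol : l (m - 2 + L) = 0
  · by_cases hrow : l 0 ≤ m - 2 + L
    · exact starOp_mono (Bset_subset_typeOne hm) subset_rfl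
        (Bset_subset_starOp hm hn (by omega) (by omega) hLn hL
          (mem_Bset_iff.mpr ⟨hlp, hs, hrow, hcol⟩))
    · obtain ⟨ν, hν, h⟩ := exists_LRPos_consPart hlp isPartition_zero (fun _ => Nat.zero_le _)
        (a := m) (b := l 0 - m) (n := n) (L := L) (by omega) (by rw [psize_const_zero]; omega)
        (by omega) (by omega) (by omega)
      exact mem_starOp hlp (rowP_mem_typeOne hm) hν hν.1.1 h
  · have h1 := hlp.add_le_psize hcol
    have hlL : l L ≤ 1 := by
      by_contra hlt
      have := hlp.add_add_two_le_psize (show 2 ≤ l L by omega) hcol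
      omega
    have hle : ∀ i, colP m i ≤ l i := fun i => by
      rw [colP]
      split_ifs with hi
      · have := hlp.1 (show i ≤ m - 2 + L by omega)
        omega
      · exact Nat.zero_le _
    have hν := colWeight_mem_Bset hlp (isPartition_colP m) hle (n := n) (a := 0) (t := L)
      (by rw [psize_colP, hs]) (by simp) (fun i => by
        rw [colP]
        split_ifs with hi
        · exact (hlp.1 (Nat.le_add_left L i)).trans hlL
        · exact (hlp.1 (show m + L ≤ i + L by omega)).trans hmL.le) (by omega)
    exact mem_starOp hlp (colP_mem_typeOne hm) hν hν.1.1
      (LRPos_colWeight hlp (isPartition_colP m) hle)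

lemma Bset_subset_starOp_typeOne_right {m n : ℕ} (hm : 27 ≤ m) (hn : 27 ≤ n) :
    Bset (m + n) (m - 1 + n) ⊆ starOp (Bset m (m - 1)) (typeOne n) := by
  intro l hl
  obtain ⟨hlp, hs, h0, hmn⟩ := mem_Bset_iff.mp hl
  by_cases hcol : l (m - 1 + (n - 2)) = 0
  · by_cases hrow : l 0 ≤ m - 1 + (n - 2)
    · exact starOp_mono subset_rfl (Bset_subset_typeOne hn)
        (Bset_subset_starOp hm hn (by omega) (by omega) (by omega) (by omega)
          (mem_Bset_iff.mpr ⟨hlp, hs, hrow, hcol⟩))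
    · have h01 := hlp.apply_zero_add_apply_one_le_psize
      have htail := psize_consPart hlp.tail (l 0)
      rw [consPart_tail] at htail
      have hμ : IsPartition (consPart (l 0 - n) fun i => l (i + 1)) :=
        hlp.tail.consPart (by simp only [zero_add]; omega)
      have hμs : psize (consPart (l 0 - n) fun i => l (i + 1)) = m := by
        rw [psize_consPart hlp.tail]
        omega
      refine mem_starOp hlp (mem_Bset_iff.mpr ⟨hμ, hμs, ?_, ?_⟩) (rowP_mem_typeOne hn)
        (isPartition_rowP n) (LRPos_rowP hlp hμ (fun i => ?_) (by omega) fun i => ?_)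
      · simp only [consPart, if_true]
        omega
      · rw [consPart, if_neg (by omega)]
        exact hlp.tail.apply_eq_zero_of_psize_le (by omega)
      · cases i <;> simp [consPart]
      · cases i with
        | zero =>
          simp only [consPart, if_true, zero_add]
          omega
        | succ i => simpa [consPart] using hlp.1 (show i + 1 ≤ i + 1 + 1 by omega)
  · set h := conj l 0 with hh
    have hlh : l h = 0 := Nat.le_zero.mp (hlp.conj_le_iff.mp le_rfl)
    have hlt : ∀ i, i < h → l i ≠ 0 := fun i hi h' => by
      have := hlp.conj_le_iff.mpr h'.le
      omega
    have hle : h ≤ m - 1 + n := hlp.conj_le_iff.mpr hmn.le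
    have hge : m - 1 + (n - 2) < h := by
      by_contra hlt
      have := hlp.1 (show h ≤ m - 1 + (n - 2) by omega)
      omega
    have hc1 : l (h - n) ≤ 1 := by
      by_contra hlt'
      have := hlp.add_add_two_le_psize (show 2 ≤ l (h - n) by omega) (hlt (h - 1) (by omega))
      omega
    have h0h := hlp.add_le_psize (hlt (h - 1) (by omega))
    have hμ : IsPartition fun i => if i < h - n then l i else 0 := by
      refine ⟨fun i j hij => ?_, h - n, fun i hi => if_neg (by omega)⟩
      have := hlp.1 hij
      dsimp only
      split_ifs <;> omega
    have hμs : psize l = psize (fun i => if i < h - n then l i else 0) + n := by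
      have hsum : ∑ i ∈ Finset.range n, l (h - n + i) = ∑ i ∈ Finset.range n, 1 :=
        Finset.sum_congr rfl fun i hi => by
          simp only [Finset.mem_range] at hi
          have h1 := hlp.1 (show h - n ≤ h - n + i by omega)
          have h2 := hlt (h - n + i) (by omega)
          omega
      rw [psize_eq_sum (D := h - n + n) fun i hi => by
          have := hlp.1 (show h ≤ i by omega)
          omega,
        psize_eq_sum (D := h - n) fun i hi => if_neg (by omega), Finset.sum_range_add, hsum,
        Finset.sum_congr rfl fun i hi => if_pos (Finset.mem_range.mp hi)]
      simp
    refine mem_starOp hlp (mem_Bset_iff.mpr ⟨hμ, by omega, ?_, if_neg (by omega)⟩)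
      (colP_mem_typeOne hn) (isPartition_colP n) (LRPos_colP hlp hμ (fun i => ?_) hμs fun i => ?_)
    · split_ifs <;> omega
    · split_ifs <;> omega
    · split_ifs with hi
      · omega
      · exact fun _ => (hlp.1 (show h - n ≤ i by omega)).trans hc1

lemma Bset_subset_starOp_typeOne_typeOne {m n : ℕ} (hm : 27 ≤ m) (hn : 27 ≤ n) :
    Bset (m + n) (m + n) ⊆ starOp (typeOne m) (typeOne n) := by
  intro l hl
  obtain ⟨hlp, hs, -⟩ := mem_Bset_iff.mp hl
  by_cases hcol : l (m + (n - 2)) = 0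
  · by_cases hrow : l 0 ≤ m + (n - 2)
    · exact starOp_mono subset_rfl (Bset_subset_typeOne hn)
        (Bset_subset_starOp_typeOne_left hm hn (by omega) (by omega)
          (mem_Bset_iff.mpr ⟨hlp, hs, hrow, hcol⟩))
    · have h01 := hlp.apply_zero_add_apply_one_le_psize
      have h2 : l 2 = 0 := by
        by_contra h
        have := hlp.add_le_psize h
        omega
      refine mem_starOp hlp (rowP_mem_typeOne hm) (rowP_mem_typeOne hn) (isPartition_rowP n)
        (LRPos_rowP hlp (isPartition_rowP m) (fun i => ?_) (by rw [psize_rowP, hs]) fun i => ?_)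
      · cases i with
        | zero =>
          simp only [rowP, consPart, if_true]
          omega
        | succ i => simp [rowP, consPart]
      · cases i with
        | zero =>
          simp only [rowP, consPart, if_true, zero_add]
          omega
        | succ i => simpa [rowP, consPart, h2] using hlp.1 (show 2 ≤ i + 1 + 1 by omega)
  · have h0 := hlp.add_le_psize hcol
    have hpos : ∀ i, i ≤ m + (n - 2) → l i ≠ 0 := fun i hi h => by
      have := hlp.1 hi
      omega
    by_cases h1 : l 0 ≤ 1
    · refine mem_starOp hlp (colP_mem_typeOne hm) (colP_mem_typeOne hn) (isPartition_colP n)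
        (LRPos_colP hlp (isPartition_colP m) (fun i => ?_) (by rw [psize_colP, hs])
          fun i _ => (hlp.1 (Nat.zero_le i)).trans h1)
      rw [colP]
      split_ifs with hi
      · have := hpos i (by omega)
        omega
      · exact Nat.zero_le _
    · have hl1 : l 1 ≤ 1 := by
        by_contra h
        have := hlp.add_add_two_le_psize (show 2 ≤ l 1 by omega) hcol
        omega
      have htail := psize_consPart hlp.tail (l 0)
      rw [consPart_tail] at htail
      have h := (LRPos_colP hlp.tail (isPartition_colP (m - 1)) (n := n - 1) (fun i => by
        rw [colP]
        split_ifs with hi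
        · have := hpos (i + 1) (by omega)
          omega
        · exact Nat.zero_le _) (by rw [psize_colP]; omega)
        fun i _ => (hlp.1 (show 1 ≤ i + 1 by omega)).trans hl1).consPart hlp.tail
          (a := 1) (b := 1) (by simp only [colP]; split_ifs <;> omega)
      have hcons : ∀ k, 27 ≤ k → consPart 1 (colP (k - 1)) = colP k := fun k hk => by
        funext i
        simp only [consPart, colP]
        split_ifs <;> omega
      rw [hcons m hm, hcons n hn, show 1 + 1 = l 0 by omega, consPart_tail] at h
      exact mem_starOp hlp (colP_mem_typeOne hm) (colP_mem_typeOne hn) (isPartition_colP n) h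

lemma starOp_Bset_eq {A : Set (ℕ → ℕ)} {m M n N : ℕ} (hm : 27 ≤ m) (hn : 27 ≤ n)
    (hA : (A = typeOne m ∧ M = m) ∨ (A = Bset m (m - 1) ∧ M = m - 1)) (hNn : N ≤ n)
    (hN : 12 * n ≤ 13 * N) : starOp A (Bset n N) = Bset (m + n) (M + N) := by
  rcases hA with ⟨rfl, hM⟩ | ⟨rfl, hM⟩ <;> rw [hM]
  · exact ((starOp_mono (typeOne_subset_Bset m) subset_rfl).trans
      (starOp_Bset_subset ..)).antisymm (Bset_subset_starOp_typeOne_left hm hn hNn hN)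
  · exact (starOp_Bset_subset ..).antisymm
      (Bset_subset_starOp hm hn (by omega) (by omega) hNn hN)

lemma starOp_eq {A B : Set (ℕ → ℕ)} {m M n N : ℕ} (hm : 27 ≤ m) (hn : 27 ≤ n)
    (hA : (A = typeOne m ∧ M = m) ∨ (A = Bset m (m - 1) ∧ M = m - 1))
    (hB : (B = typeOne n ∧ N = n) ∨ (B = Bset n (n - 1) ∧ N = n - 1)) :
    starOp A B = Bset (m + n) (M + N) := by
  rcases hB with ⟨rfl, hN⟩ | ⟨rfl, hN⟩ <;> rw [hN]
  · rcases hA with ⟨rfl, hM⟩ | ⟨rfl, hM⟩ <;> rw [hM]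
    · exact ((starOp_mono (typeOne_subset_Bset m) (typeOne_subset_Bset n)).trans
        (starOp_Bset_subset ..)).antisymm (Bset_subset_starOp_typeOne_typeOne hm hn)
    · exact ((starOp_mono subset_rfl (typeOne_subset_Bset n)).trans
        (starOp_Bset_subset ..)).antisymm (Bset_subset_starOp_typeOne_right hm hn)
  · exact starOp_Bset_eq hm hn hA (by omega) (by omega)

lemma starAll_ofFn_eq (R : ℕ) (hR : 2 ≤ R) (m : Fin R → ℕ) (hm : ∀ i, 27 ≤ m i)
    (A : Fin R → Set (ℕ → ℕ)) (N : Fin R → ℕ)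
    (hA : ∀ i, (A i = typeOne (m i) ∧ N i = m i) ∨
      (A i = Bset (m i) (m i - 1) ∧ N i = m i - 1)) :
    starAll (List.ofFn A) = Bset (∑ i, m i) (∑ i, N i) := by
  induction R, hR using Nat.le_induction with
  | base =>
    simpa [List.ofFn_succ, starAll, Fin.sum_univ_two] using
      starOp_eq (hm 0) (hm 1) (hA 0) (hA 1)
  | succ R hR ih =>
    have htail := ih (fun i => m i.succ) (fun i => hm _) (fun i => A i.succ) (fun i => N i.succ)
      fun i => hA _
    obtain ⟨r, rfl⟩ : ∃ r, R = r + 1 := ⟨R - 1, by omega⟩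
    have hunfold : starAll (List.ofFn A) = starOp (A 0) (starAll (List.ofFn fun i => A i.succ)) := by
      simp only [List.ofFn_succ, starAll]
    have hsum : ∑ i : Fin (r + 1), 27 ≤ ∑ i : Fin (r + 1), m i.succ :=
      Finset.sum_le_sum fun i _ => hm _
    have hle : ∑ i : Fin (r + 1), N i.succ ≤ ∑ i : Fin (r + 1), m i.succ :=
      Finset.sum_le_sum fun i _ => by
        rcases hA i.succ with h | h <;> omega
    have hge : ∑ i : Fin (r + 1), m i.succ ≤ ∑ i : Fin (r + 1), (N i.succ + 1) :=
      Finset.sum_le_sum fun i _ => by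
        rcases hA i.succ with h | h <;> omega
    rw [Finset.sum_add_distrib] at hge
    simp only [Finset.sum_const, Finset.card_univ, Fintype.card_fin, smul_eq_mul] at hsum hge
    rw [hunfold, htail, Fin.sum_univ_succ m, Fin.sum_univ_succ N]
    exact starOp_Bset_eq (hm 0) (by omega) (hA 0) hle (by omega)

/-- let `R ≥ 2`, `k_1, …, k_R ≥ 3` with each value occurring at
most twice, and for each `i` let `A_i` be either
`P(3^{k_i}) ∖ {(3^{k_i}−1, 1), (2, 1^{3^{k_i}−2})}` (with `N_i = 3^{k_i}`) or
`B_{3^{k_i}}(3^{k_i}−1)` (with `N_i = 3^{k_i}−1`).  Then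
`A_1 ⋆ ⋯ ⋆ A_R = B_n(N_1 + ⋯ + N_R)` where `n = 3^{k_1} + ⋯ + 3^{k_R}`. -/
theorem star_types_one_two (R : ℕ) (hR : 2 ≤ R) (k : Fin R → ℕ)
    (hk : ∀ i, 3 ≤ k i)
    (hmult : ∀ v : ℕ, (Finset.univ.filter fun i => k i = v).card ≤ 2)
    (A : Fin R → Set (ℕ → ℕ)) (N : Fin R → ℕ)
    (hA : ∀ i,
      (A i = Pset (3 ^ k i) \ {ofList [3 ^ k i - 1, 1], hookP 2 (3 ^ k i - 2)} ∧
        N i = 3 ^ k i) ∨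
      (A i = Bset (3 ^ k i) (3 ^ k i - 1) ∧ N i = 3 ^ k i - 1)) :
    starAll (List.ofFn A) = Bset (∑ i, 3 ^ k i) (∑ i, N i) := by
  exact starAll_ofFn_eq R hR (fun i => 3 ^ k i)
    (fun i => (Nat.pow_le_pow_right (by norm_num) (hk i) : 3 ^ 3 ≤ 3 ^ k i)) A N hA

end SylowBranching
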